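/- arXiv:1604.00243 — 9 statements merged into one kernel-verified Lean document; each statement's English description precedes it below -/
import Mathlib

section
/- Let A, B be n×n quaternion matrices with A Hermitian positive definite and B Hermitian. Then there exists an invertible matrix C ∈ ℍ^{n×n} and a vector d ∈ ℝⁿ such that Cᴴ A C = I_n and Cᴴ B C equals the diagonal matrix whose diagonal entries are the real numbers d₁,…,dₙ (regarded as quaternions). -/
open scoped Quaternion
open Matrix

/-- A quaternion matrix is Hermitian positive definite. -/
def IsPosDef {k : ℕ} (M : Matrix (Fin k) (Fin k) ℍ[ℝ]) : Prop :=
  Mᴴ = M ∧ ∀ x : Fin k → ℍ[ℝ], x ≠ 0 →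
    ∃ r : ℝ, 0 < r ∧ star x ⬝ᵥ M.mulVec x = (r : ℍ[ℝ])

/-- In a nontrivial finite-dimensional real vector space, a symmetric bilinear form `b` has an
eigenvector relative to a positive definite symmetric bilinear form `a`. -/
theorem exists_relative_eigenvector {V : Type*} [AddCommGroup V] [Module ℝ V]
    [FiniteDimensional ℝ V] [Nontrivial V] (a b : LinearMap.BilinForm ℝ V)
    (ha : ∀ x y, a x y = a y x) (hb : ∀ x y, b x y = b y x) (hpos : ∀ x, x ≠ 0 → 0 < a x x) :
    ∃ (x : V) (r : ℝ), x ≠ 0 ∧ ∀ y, b x y = r * a x y := by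
  have hdef : ∀ x, a x x = 0 → x = 0 := fun x hx ↦ by
    by_contra h
    exact (hpos x h).ne' hx
  have hnd : a.Nondegenerate :=
    ⟨fun x hx ↦ hdef x (hx x), fun x hx ↦ hdef x (hx x)⟩
  let core : InnerProductSpace.Core ℝ V :=
    { inner := fun x y ↦ a x y
      conj_inner_symm := fun x y ↦ ha y x
      re_inner_nonneg := fun x ↦ by
        by_cases hx : x = 0
        · simp [hx]
        · exact (hpos x hx).le
      add_left := fun x y z ↦ by simp
      smul_left := fun x y r ↦ by simp
      definite := hdef }
  let _ : NormedAddCommGroup V := core.toNormedAddCommGroup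
  let _ : InnerProductSpace ℝ V := InnerProductSpace.ofCore core.toCore
  let T : V →ₗ[ℝ] V := (a.toDual hnd).symm.toLinearMap ∘ₗ b
  have hT (x y : V) : a (T x) y = b x y :=
    LinearMap.BilinForm.apply_toDual_symm_apply (hB := hnd) (b x) y
  have hsymm : T.IsSymmetric := fun x y ↦ by
    change a (T x) y = a x (T y)
    rw [hT, ha x, hT, hb]
  obtain ⟨r, hr⟩ : ∃ r : ℝ, Module.End.HasEigenvalue T r :=
    ⟨_, hsymm.hasEigenvalue_iSup_of_finiteDimensional⟩
  obtain ⟨x, hx⟩ := hr.exists_hasEigenvector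
  refine ⟨x, r, hx.2, fun y ↦ ?_⟩
  rw [← hT, hx.apply_eq_smul, map_smul, LinearMap.smul_apply, smul_eq_mul]

/-- The form `(x, y) ↦ xᴴ M y` of a quaternion matrix `M`, as a real bilinear map. -/
noncomputable def sesqForm {n : ℕ} (M : Matrix (Fin n) (Fin n) ℍ[ℝ]) :
    (Fin n → ℍ[ℝ]) →ₗ[ℝ] (Fin n → ℍ[ℝ]) →ₗ[ℝ] ℍ[ℝ] :=
  LinearMap.mk₂ ℝ (fun x y ↦ star x ⬝ᵥ M *ᵥ y)
    (fun x y z ↦ by rw [star_add, add_dotProduct])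
    (fun c x y ↦ by
      rw [show star (c • x) = c • star x from funext fun i ↦ Quaternion.star_smul c (x i),
        smul_dotProduct])
    (fun x y z ↦ by rw [mulVec_add, dotProduct_add])
    (fun c x y ↦ by rw [mulVec_smul, dotProduct_smul])

theorem sesqForm_apply {n : ℕ} (M : Matrix (Fin n) (Fin n) ℍ[ℝ]) (x y : Fin n → ℍ[ℝ]) :
    sesqForm M x y = star x ⬝ᵥ M *ᵥ y := rfl

theorem star_sesqForm {n : ℕ} {M : Matrix (Fin n) (Fin n) ℍ[ℝ]} (hM : Mᴴ = M)
    (x y : Fin n → ℍ[ℝ]) : star (sesqForm M x y) = sesqForm M y x := by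
  rw [sesqForm_apply, sesqForm_apply, ← star_dotProduct_star, star_star, star_mulVec, hM,
    dotProduct_mulVec]

theorem sesqForm_op_smul_right {n : ℕ} (M : Matrix (Fin n) (Fin n) ℍ[ℝ]) (x y : Fin n → ℍ[ℝ])
    (q : ℍ[ℝ]) : sesqForm M x (MulOpposite.op q • y) = sesqForm M x y * q := by
  rw [sesqForm_apply, mulVec_smul, dotProduct_smul, op_smul_eq_mul, sesqForm_apply]

/-- A subspace that is closed under right multiplication by quaternions and nonzero contains a
vector, normalized with respect to `A`, on which `B` is a real multiple of `A`. -/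
theorem exists_normalized_eigenvector {n : ℕ} {A B : Matrix (Fin n) (Fin n) ℍ[ℝ]}
    (hA : IsPosDef A) (hB : Bᴴ = B) (W : Submodule ℝ (Fin n → ℍ[ℝ])) (hW : W ≠ ⊥)
    (hWop : ∀ y ∈ W, ∀ q : ℍ[ℝ], MulOpposite.op q • y ∈ W) :
    ∃ x ∈ W, ∃ r : ℝ, sesqForm A x x = 1 ∧ ∀ y ∈ W, sesqForm B x y = r • sesqForm A x y := by
  have : Nontrivial W := Submodule.nontrivial_iff_ne_bot.mpr hW
  let reForm (M : Matrix (Fin n) (Fin n) ℍ[ℝ]) : LinearMap.BilinForm ℝ W :=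
    LinearMap.mk₂ ℝ (fun x y ↦ (sesqForm M x y).re) (by simp) (by simp) (by simp) (by simp)
  have hsymm {M : Matrix (Fin n) (Fin n) ℍ[ℝ]} (hM : Mᴴ = M) (x y : W) :
      reForm M x y = reForm M y x := by
    change (sesqForm M x y).re = (sesqForm M y x).re
    rw [← star_sesqForm hM, Quaternion.re_star]
  obtain ⟨x, r, hx, hxr⟩ := exists_relative_eigenvector (reForm A) (reForm B)
    (hsymm hA.1) (hsymm hB) (fun x hx ↦ by
      obtain ⟨s, hs, h⟩ := hA.2 x (by simpa using hx)
      change 0 < (sesqForm A x x).re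
      rwa [sesqForm_apply, h, Quaternion.re_coe])
  have heig (y : Fin n → ℍ[ℝ]) (hy : y ∈ W) :
      sesqForm B x y = r • sesqForm A x y := by
    have hre (q : ℍ[ℝ]) : ((sesqForm B x y - r • sesqForm A x y) * q).re = 0 := by
      have h : (sesqForm B x (MulOpposite.op q • y)).re
          = r * (sesqForm A x (MulOpposite.op q • y)).re := hxr ⟨_, hWop y hy q⟩
      rw [sesqForm_op_smul_right, sesqForm_op_smul_right] at h
      rw [sub_mul, smul_mul_assoc, Quaternion.re_sub, Quaternion.re_smul, h, smul_eq_mul, sub_self]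
    have h := hre (star (sesqForm B x y - r • sesqForm A x y))
    rw [← Quaternion.normSq_def, Quaternion.normSq_eq_zero] at h
    exact sub_eq_zero.mp h
  obtain ⟨s, hs, hxs⟩ := hA.2 x (by simpa using hx)
  refine ⟨(√s)⁻¹ • x, W.smul_mem _ x.2, r, ?_, fun y hy ↦ ?_⟩
  · rw [map_smul, map_smul, LinearMap.smul_apply, sesqForm_apply, hxs, smul_smul, ← mul_inv,
      Real.mul_self_sqrt hs.le, Quaternion.smul_coe, inv_mul_cancel₀ hs.ne', Quaternion.coe_one]
  · rw [LinearMap.map_smul₂, LinearMap.map_smul₂, heig y hy, smul_comm]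

/-- Families orthonormal for `A` and diagonalizing `B`, whose `A`-orthogonal complement is
also `B`-orthogonal, exist in every length up to the dimension. -/
theorem exists_orthonormal_diagonalizing_family {n : ℕ} {A B : Matrix (Fin n) (Fin n) ℍ[ℝ]}
    (hA : IsPosDef A) (hB : Bᴴ = B) {k : ℕ} (hk : k ≤ n) :
    ∃ (v : Fin k → Fin n → ℍ[ℝ]) (d : Fin k → ℝ),
      (∀ i j, sesqForm A (v i) (v j) = if i = j then 1 else 0) ∧
      (∀ i j, sesqForm B (v i) (v j) = if i = j then (d i : ℍ[ℝ]) else 0) ∧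
      ∀ y, (∀ i, sesqForm A (v i) y = 0) → ∀ i, sesqForm B (v i) y = 0 := by
  induction k with
  | zero => exact ⟨Fin.elim0, Fin.elim0, fun i ↦ i.elim0, fun i ↦ i.elim0, fun _ _ i ↦ i.elim0⟩
  | succ k ih =>
    obtain ⟨v, d, hAv, hBv, hv⟩ := ih (by omega)
    let f : (Fin n → ℍ[ℝ]) →ₗ[ℝ] (Fin k → ℍ[ℝ]) := LinearMap.pi fun i ↦ sesqForm A (v i)
    have hmem (y : Fin n → ℍ[ℝ]) : y ∈ LinearMap.ker f ↔ ∀ i, sesqForm A (v i) y = 0 := by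
      rw [LinearMap.mem_ker, funext_iff]
      rfl
    have hker : LinearMap.ker f ≠ ⊥ := LinearMap.ker_ne_bot_of_finrank_lt (by
      simp only [Module.finrank_pi_fintype, Quaternion.finrank_eq_four, Finset.sum_const,
        Finset.card_univ, Fintype.card_fin, smul_eq_mul]
      omega)
    obtain ⟨x, hxW, r, hx1, hxr⟩ := exists_normalized_eigenvector hA hB (LinearMap.ker f) hker
      (fun y hy q ↦ (hmem _).2 fun i ↦ by
        rw [sesqForm_op_smul_right, (hmem y).1 hy i, zero_mul])
    have hAx := (hmem x).1 hxW
    have hBx := hv x hAx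
    have hAx' (i : Fin k) : sesqForm A x (v i) = 0 := by
      rw [← star_sesqForm hA.1, hAx, star_zero]
    have hBx' (i : Fin k) : sesqForm B x (v i) = 0 := by
      rw [← star_sesqForm hB, hBx, star_zero]
    have hBxx : sesqForm B x x = (r : ℍ[ℝ]) := by
      rw [hxr x hxW, hx1, ← Quaternion.coe_one, Quaternion.smul_coe, mul_one]
    refine ⟨Fin.cons x v, Fin.cons r d, fun i j ↦ ?_, fun i j ↦ ?_, fun y hy i ↦ ?_⟩
    · cases i using Fin.cases <;> cases j using Fin.cases <;>
        simp [hx1, hAx, hAx', hAv, Fin.succ_ne_zero, (Fin.succ_ne_zero _).symm]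
    · cases i using Fin.cases <;> cases j using Fin.cases <;>
        simp [hBxx, hBx, hBx', hBv, Fin.succ_ne_zero, (Fin.succ_ne_zero _).symm]
    · have hyW : ∀ i, sesqForm A (v i) y = 0 := fun i ↦ by simpa using hy i.succ
      cases i using Fin.cases with
      | zero =>
        have hy0 : sesqForm A x y = 0 := by simpa using hy 0
        rw [Fin.cons_zero, hxr y ((hmem y).2 hyW), hy0, smul_zero]
      | succ i => simpa using hv y hyW i

/-- Simultaneous reduction: positive definite `A` and Hermitian `B` can be
simultaneously brought to `I` and a real diagonal matrix by a congruence. -/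
theorem stmt0 {n : ℕ} (A B : Matrix (Fin n) (Fin n) ℍ[ℝ])
    (hA : IsPosDef A) (hB : Bᴴ = B) :
    ∃ (C : Matrix (Fin n) (Fin n) ℍ[ℝ]) (d : Fin n → ℝ),
      IsUnit C ∧ Cᴴ * A * C = 1 ∧
      Cᴴ * B * C = Matrix.diagonal (fun i => (d i : ℍ[ℝ])) := by
  obtain ⟨v, d, hAv, hBv, -⟩ := exists_orthonormal_diagonalizing_family hA hB le_rfl
  have hentry (M : Matrix (Fin n) (Fin n) ℍ[ℝ]) (i j : Fin n) :
      ((Matrix.of v)ᵀᴴ * M * (Matrix.of v)ᵀ) i j = sesqForm M (v i) (v j) := by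
    rw [Matrix.mul_assoc]
    rfl
  have hone : (Matrix.of v)ᵀᴴ * A * (Matrix.of v)ᵀ = 1 := by
    ext1 i j
    rw [hentry, hAv, Matrix.one_apply]
  refine ⟨(Matrix.of v)ᵀ, d, IsUnit.of_mul_eq_one_right _ hone, hone, ?_⟩
  ext1 i j
  rw [hentry, hBv, Matrix.diagonal_apply]
end

section
/- Let A ∈ ℍ^{m×n}, and let M ∈ ℍ^{m×m} and N ∈ ℍ^{n×n} be Hermitian positive definite matrices, with N invertible with two-sided inverse N⁻¹. Then there exist matrices U ∈ ℍ^{m×m} and V ∈ ℍ^{n×n} satisfying Uᴴ M U = I_m and Vᴴ N⁻¹ V = I_n, a natural number r ≤ min(m,n), and real numbers σ₁ ≥ σ₂ ≥ … ≥ σ_r > 0, such that A = U D Vᴴ, where D ∈ ℍ^{m×n} is the matrix whose (i,i) entry equals σ_i for 1 ≤ i ≤ r and all of whose other entries are zero (the weighted singular value decomposition of A). -/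
open scoped Quaternion
open Matrix

/-- The sesquilinear form `xᴴ M y` attached to a square quaternion matrix. -/
noncomputable def wform {k : ℕ} (M : Matrix (Fin k) (Fin k) ℍ[ℝ]) (x y : Fin k → ℍ[ℝ]) : ℍ[ℝ] :=
  star x ⬝ᵥ M *ᵥ y

section wform

variable {k : ℕ} (M : Matrix (Fin k) (Fin k) ℍ[ℝ]) (x y z : Fin k → ℍ[ℝ])

lemma wform_add_left : wform M (x + y) z = wform M x z + wform M y z := by
  simp [wform, add_dotProduct]

lemma wform_add_right : wform M x (y + z) = wform M x y + wform M x z := by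
  simp [wform, mulVec_add, dotProduct_add]

lemma wform_smul_left (t : ℝ) : wform M (t • x) y = t • wform M x y := by
  have h : star (t • x) = t • star x := by ext1; simp
  simp [wform, h, smul_dotProduct]

lemma wform_smul_right (t : ℝ) : wform M x (t • y) = t • wform M x y := by
  simp [wform, mulVec_smul, dotProduct_smul]

lemma wform_op_smul_right (q : ℍ[ℝ]) :
    wform M x (MulOpposite.op q • y) = wform M x y * q := by
  simp [wform, mulVec_smul, dotProduct_smul]

lemma wform_zero_left : wform M 0 y = 0 := by
  simp [wform]

lemma wform_conjTranspose : wform Mᴴ x y = star (wform M y x) := by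
  rw [wform, wform, star_dotProduct, star_mulVec, conjTranspose_conjTranspose, ← dotProduct_mulVec]

lemma continuous_wform : Continuous fun x => wform M x x := by
  unfold wform; fun_prop

lemma continuous_wform_right : Continuous fun y => wform M x y := by
  unfold wform; fun_prop

end wform

namespace IsPosDef

variable {k : ℕ} {M : Matrix (Fin k) (Fin k) ℍ[ℝ]}

lemma wform_star (hM : IsPosDef M) (x y : Fin k → ℍ[ℝ]) :
    star (wform M y x) = wform M x y := by
  rw [← wform_conjTranspose, hM.1]

lemma wform_symm_zero (hM : IsPosDef M) {x y : Fin k → ℍ[ℝ]} (h : wform M x y = 0) :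
    wform M y x = 0 := by
  rw [← hM.wform_star, h, star_zero]

lemma wform_op_smul_left (hM : IsPosDef M) (x y : Fin k → ℍ[ℝ]) (q : ℍ[ℝ]) :
    wform M (MulOpposite.op q • x) y = star q * wform M x y := by
  rw [← hM.wform_star, wform_op_smul_right, star_mul, hM.wform_star]

lemma wform_self_re_pos (hM : IsPosDef M) {x : Fin k → ℍ[ℝ]} (hx : x ≠ 0) :
    0 < (wform M x x).re := by
  obtain ⟨r, hr, h⟩ := hM.2 x hx
  simpa [wform, h] using hr

lemma wform_self_re_nonneg (hM : IsPosDef M) (x : Fin k → ℍ[ℝ]) :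
    0 ≤ (wform M x x).re := by
  by_cases hx : x = 0
  · simp [hx, wform_zero_left]
  · exact (hM.wform_self_re_pos hx).le

lemma wform_self (hM : IsPosDef M) (x : Fin k → ℍ[ℝ]) :
    wform M x x = (((wform M x x).re : ℝ) : ℍ[ℝ]) := by
  by_cases hx : x = 0
  · simp [hx, wform_zero_left]
  · obtain ⟨r, hr, h⟩ := hM.2 x hx
    rw [show wform M x x = r from h, Quaternion.re_coe]

lemma wform_add_op_smul_self_re (hM : IsPosDef M) (x y : Fin k → ℍ[ℝ]) (q : ℍ[ℝ]) :
    (wform M (x + MulOpposite.op q • y) (x + MulOpposite.op q • y)).re =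
      (wform M x x).re + 2 * (wform M x y * q).re +
        Quaternion.normSq q * (wform M y y).re := by
  have h : wform M (MulOpposite.op q • y) x = star (wform M x y * q) := by
    rw [hM.wform_op_smul_left, star_mul, hM.wform_star]
  have h' : (wform M (MulOpposite.op q • y) (MulOpposite.op q • y)).re =
      Quaternion.normSq q * (wform M y y).re := by
    rw [hM.wform_op_smul_left, wform_op_smul_right, hM.wform_self, Quaternion.re_coe,
      Quaternion.coe_commutes, ← mul_assoc, Quaternion.star_mul_self, ← Quaternion.coe_mul,
      Quaternion.re_coe]
  rw [wform_add_left, wform_add_right, wform_add_right, h, Quaternion.re_add, Quaternion.re_add,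
    Quaternion.re_add, h', Quaternion.re_star, wform_op_smul_right]
  ring

lemma wform_normalize (hM : IsPosDef M) {x : Fin k → ℍ[ℝ]} (hx : x ≠ 0) :
    wform M ((√(wform M x x).re)⁻¹ • x) ((√(wform M x x).re)⁻¹ • x) = 1 := by
  have hp := hM.wform_self_re_pos hx
  rw [wform_smul_left, wform_smul_right, smul_smul, ← mul_inv, Real.mul_self_sqrt hp.le,
    hM.wform_self x, Quaternion.re_coe, Quaternion.smul_coe, inv_mul_cancel₀ hp.ne',
    Quaternion.coe_one]

lemma wform_orthonormal_update (hM : IsPosDef M) {u : ℕ → Fin k → ℍ[ℝ]} {l : ℕ}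
    (hu : ∀ i < l, ∀ j < l, wform M (u i) (u j) = if i = j then 1 else 0)
    {x : Fin k → ℍ[ℝ]} (hx : wform M x x = 1) (hux : ∀ i < l, wform M (u i) x = 0) :
    ∀ i < l + 1, ∀ j < l + 1, wform M (Function.update u l x i) (Function.update u l x j) =
      if i = j then 1 else 0 := by
  intro i hi j hj
  rcases Nat.lt_succ_iff_lt_or_eq.mp hi with hi | rfl <;>
    rcases Nat.lt_succ_iff_lt_or_eq.mp hj with hj | rfl
  · rw [Function.update_of_ne hi.ne, Function.update_of_ne hj.ne, hu i hi j hj]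
  · rw [Function.update_of_ne hi.ne, Function.update_self, hux i hi, if_neg hi.ne]
  · rw [Function.update_of_ne hj.ne, Function.update_self, hM.wform_symm_zero (hux j hj),
      if_neg hj.ne']
  · simp [hx]

lemma inverse (hM : IsPosDef M) {M' : Matrix (Fin k) (Fin k) ℍ[ℝ]}
    (h₁ : M * M' = 1) : IsPosDef M' := by
  have hH : M'ᴴ = M' := by
    have : M'ᴴ * M = 1 := by
      rw [← hM.1, ← conjTranspose_mul, h₁, conjTranspose_one]
    exact left_inv_eq_right_inv this h₁
  refine ⟨hH, fun x hx => ?_⟩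
  have hx' : M' *ᵥ x ≠ 0 := fun h => hx <| by
    rw [← one_mulVec x, ← h₁, ← mulVec_mulVec, h, mulVec_zero]
  obtain ⟨r, hr, h⟩ := hM.2 _ hx'
  refine ⟨r, hr, ?_⟩
  rw [← h, star_mulVec, hH, mulVec_mulVec, h₁, one_mulVec, ← dotProduct_mulVec]

end IsPosDef

lemma exists_ne_zero_wform_eq_zero {n k : ℕ} (N : Matrix (Fin n) (Fin n) ℍ[ℝ])
    (hN : IsPosDef N) (hk : k < n) (v : ℕ → Fin n → ℍ[ℝ]) :
    ∃ x ≠ 0, ∀ i < k, wform N (v i) x = 0 := by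
  let W : Matrix (Fin n) (Fin k) ℍ[ℝ] := Matrix.of fun a i => (N *ᵥ v i) a
  have hker : LinearMap.ker (Matrix.toLinearMapRight' W) ≠ ⊥ :=
    LinearMap.ker_ne_bot_of_finrank_lt (by simpa using hk)
  obtain ⟨y, hy, hy0⟩ := Submodule.exists_mem_ne_zero_of_ne_bot hker
  refine ⟨star y, star_ne_zero.mpr hy0, fun i hi => hN.wform_symm_zero ?_⟩
  have := congrFun (LinearMap.mem_ker.mp hy) ⟨i, hi⟩
  simpa [wform, W, vecMul, dotProduct] using this

lemma le_of_wform_orthonormal {m r : ℕ} (M : Matrix (Fin m) (Fin m) ℍ[ℝ])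
    (u : ℕ → Fin m → ℍ[ℝ])
    (hu : ∀ i < r, ∀ j < r, wform M (u i) (u j) = if i = j then 1 else 0) : r ≤ m := by
  by_contra! h
  let W : Matrix (Fin r) (Fin m) ℍ[ℝ] := Matrix.of fun i a => star (u i a)
  have hker : LinearMap.ker (Matrix.toLinearMapRight' W) ≠ ⊥ :=
    LinearMap.ker_ne_bot_of_finrank_lt (by simpa using h)
  obtain ⟨y, hy, hy0⟩ := Submodule.exists_mem_ne_zero_of_ne_bot hker
  have hy' : y ᵥ* W = 0 := LinearMap.mem_ker.mp hy
  have h1 : W * (M * Wᴴ) = 1 := by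
    ext1 i j
    have := hu i i.2 j j.2
    simp only [wform, dotProduct, mulVec] at this
    simpa [W, mul_apply, one_apply, Fin.ext_iff] using this
  apply hy0
  rw [← vecMul_one y, ← h1, ← vecMul_vecMul, hy', zero_vecMul]

lemma wform_orthonormal_extend {m r : ℕ} {M : Matrix (Fin m) (Fin m) ℍ[ℝ]}
    (hM : IsPosDef M) (u : ℕ → Fin m → ℍ[ℝ])
    (hu : ∀ i < r, ∀ j < r, wform M (u i) (u j) = if i = j then 1 else 0)
    (k : ℕ) (hrk : r ≤ k) (hkm : k ≤ m) :
    ∃ w : ℕ → Fin m → ℍ[ℝ], (∀ i < r, w i = u i) ∧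
      ∀ i < k, ∀ j < k, wform M (w i) (w j) = if i = j then 1 else 0 := by
  induction k, hrk using Nat.le_induction with
  | base => exact ⟨u, fun _ _ => rfl, hu⟩
  | succ k hk ih =>
    obtain ⟨w, hw, hwo⟩ := ih (by omega)
    obtain ⟨x, hx, hwx⟩ := exists_ne_zero_wform_eq_zero M hM hkm w
    refine ⟨_, fun i hi => ?_, hM.wform_orthonormal_update hwo (hM.wform_normalize hx)
      fun i hi => by rw [wform_smul_right, hwx i hi, smul_zero]⟩
    rw [Function.update_of_ne (by omega), hw i hi]

lemma wform_exists_max {m n : ℕ} (M : Matrix (Fin m) (Fin m) ℍ[ℝ])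
    {N : Matrix (Fin n) (Fin n) ℍ[ℝ]} (hN : IsPosDef N)
    (B : Matrix (Fin m) (Fin n) ℍ[ℝ]) {k : ℕ} (hk : k < n) (v : ℕ → Fin n → ℍ[ℝ]) :
    ∃ x, wform N x x = 1 ∧ (∀ i < k, wform N (v i) x = 0) ∧
      ∀ y, (∀ i < k, wform N (v i) y = 0) →
        (wform M (B *ᵥ y) (B *ᵥ y)).re ≤
          (wform M (B *ᵥ x) (B *ᵥ x)).re * (wform N y y).re := by
  let f : (Fin n → ℍ[ℝ]) → ℝ := fun x =>
    (wform M (B *ᵥ x) (B *ᵥ x)).re / (wform N x x).re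
  have hf_smul (t : ℝ) (ht : t ≠ 0) (x) : f (t • x) = f x := by
    have ht' : t * t ≠ 0 := mul_ne_zero ht ht
    simp only [f, mulVec_smul, wform_smul_left, wform_smul_right, smul_smul,
      Quaternion.re_smul, smul_eq_mul]
    exact mul_div_mul_left _ _ ht'
  let K : Set (Fin n → ℍ[ℝ]) :=
    Metric.sphere 0 1 ∩ ⋂ i, ⋂ (_ : i < k), {x | wform N (v i) x = 0}
  have hK : IsCompact K := (isCompact_sphere 0 1).inter_right <|
    isClosed_iInter fun i => isClosed_iInter fun _ =>
      isClosed_eq (continuous_wform_right N (v i)) continuous_const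
  have hmem {x} (hx : x ≠ 0) (hvx : ∀ i < k, wform N (v i) x = 0) : ‖x‖⁻¹ • x ∈ K := by
    refine ⟨by simp [norm_smul, hx], ?_⟩
    simp only [Set.mem_iInter, Set.mem_ofPred_eq]
    intro i hi
    rw [wform_smul_right, hvx i hi, smul_zero]
  have hK0 : K.Nonempty := by
    obtain ⟨x, hx, hvx⟩ := exists_ne_zero_wform_eq_zero N hN hk v
    exact ⟨_, hmem hx hvx⟩
  have hne {x} (hx : x ∈ K) : x ≠ 0 := by
    rintro rfl
    simpa using hx.1
  have hf : ContinuousOn f K := by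
    refine ContinuousOn.div (Continuous.continuousOn ?_) (Continuous.continuousOn ?_)
      fun x hx => (hN.wform_self_re_pos (hne hx)).ne'
    · exact Quaternion.continuous_re.comp ((continuous_wform M).comp (by fun_prop))
    · exact Quaternion.continuous_re.comp (continuous_wform N)
  obtain ⟨x, hx, hmax⟩ := hK.exists_isMaxOn hK0 hf
  have hx0 := hne hx
  have hx1 := hN.wform_normalize hx0
  have hpos := Real.sqrt_pos.mpr (hN.wform_self_re_pos hx0)
  set x' := (√(wform N x x).re)⁻¹ • x with hx'
  have hfx' : (wform M (B *ᵥ x') (B *ᵥ x')).re = f x := by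
    rw [← hf_smul _ (inv_ne_zero hpos.ne') x, ← hx']
    simp [f, hx1]
  have hvx : ∀ i < k, wform N (v i) x = 0 := by simpa [K] using hx.2
  refine ⟨x', hx1, fun i hi => by rw [hx', wform_smul_right, hvx i hi, smul_zero],
    fun y hy => ?_⟩
  by_cases hy0 : y = 0
  · simp [hy0, wform_zero_left]
  · rw [hfx', ← div_le_iff₀ (hN.wform_self_re_pos hy0)]
    have := hmax (hmem hy0 hy)
    rwa [Set.mem_ofPred_eq, hf_smul _ (by simpa using hy0)] at this

lemma wform_mulVec_eq_zero_of_max {m n : ℕ} {M : Matrix (Fin m) (Fin m) ℍ[ℝ]}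
    {N : Matrix (Fin n) (Fin n) ℍ[ℝ]} (hM : IsPosDef M) (hN : IsPosDef N)
    (B : Matrix (Fin m) (Fin n) ℍ[ℝ]) {x y : Fin n → ℍ[ℝ]}
    (hx : wform N x x = 1) (hxy : wform N x y = 0)
    (hmax : ∀ q : ℍ[ℝ],
      (wform M (B *ᵥ (x + MulOpposite.op q • y)) (B *ᵥ (x + MulOpposite.op q • y))).re ≤
        (wform M (B *ᵥ x) (B *ᵥ x)).re *
          (wform N (x + MulOpposite.op q • y) (x + MulOpposite.op q • y)).re) :
    wform M (B *ᵥ x) (B *ᵥ y) = 0 := by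
  set c := wform M (B *ᵥ x) (B *ᵥ y) with hc
  by_contra hc0
  have hγ : 0 < Quaternion.normSq c :=
    lt_of_le_of_ne Quaternion.normSq_nonneg (Ne.symm (by simpa using hc0))
  set l := (wform M (B *ᵥ x) (B *ᵥ x)).re
  have hl : 0 ≤ l := hM.wform_self_re_nonneg _
  have hα := hN.wform_self_re_nonneg y
  have hβ := hM.wform_self_re_nonneg (B *ᵥ y)
  set α := (wform N y y).re
  set β := (wform M (B *ᵥ y) (B *ᵥ y)).re
  have key (t : ℝ) : 2 * t + t ^ 2 * β ≤ l * α * t ^ 2 := by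
    have h := hmax (t • star c)
    rw [mulVec_add, mulVec_smul, hM.wform_add_op_smul_self_re,
      hN.wform_add_op_smul_self_re, hx, hxy, ← hc, Quaternion.normSq_smul,
      Quaternion.normSq_star, mul_smul_comm, Quaternion.self_mul_star, zero_mul,
      Quaternion.re_smul, Quaternion.re_coe, Quaternion.re_zero, Quaternion.re_one,
      smul_eq_mul] at h
    refine le_of_mul_le_mul_left ?_ hγ
    linarith
  have hlα : 0 ≤ l * α := mul_nonneg hl hα
  have h := key (l * α + 1)⁻¹
  have h1 : (l * α + 1) * (l * α + 1)⁻¹ = 1 := mul_inv_cancel₀ (by positivity)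
  have h2 : 0 < (l * α + 1)⁻¹ := by positivity
  set t := (l * α + 1)⁻¹
  nlinarith [mul_nonneg (sq_nonneg t) hβ, sq_nonneg t]

lemma wform_exists_singular_vectors {m n : ℕ} (M : Matrix (Fin m) (Fin m) ℍ[ℝ])
    {N : Matrix (Fin n) (Fin n) ℍ[ℝ]} (hN : IsPosDef N)
    (B : Matrix (Fin m) (Fin n) ℍ[ℝ]) (k : ℕ) (hk : k ≤ n) :
    ∃ v : ℕ → Fin n → ℍ[ℝ],
      (∀ i < k, ∀ j < k, wform N (v i) (v j) = if i = j then 1 else 0) ∧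
      ∀ i < k, ∀ y, (∀ j < i, wform N (v j) y = 0) →
        (wform M (B *ᵥ y) (B *ᵥ y)).re ≤
          (wform M (B *ᵥ v i) (B *ᵥ v i)).re * (wform N y y).re := by
  induction k with
  | zero => exact ⟨0, by simp, by simp⟩
  | succ k ih =>
    obtain ⟨v, hv, hmax⟩ := ih (by omega)
    obtain ⟨x, hx, hvx, hxmax⟩ := wform_exists_max M hN B hk v
    refine ⟨_, hN.wform_orthonormal_update hv hx hvx, fun i hi y hy => ?_⟩
    have hy' : ∀ j < i, wform N (v j) y = 0 := fun j hj => by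
      simpa [Function.update_of_ne (show j ≠ k by omega)] using hy j hj
    rcases Nat.lt_succ_iff_lt_or_eq.mp hi with hi | rfl
    · rw [Function.update_of_ne hi.ne]
      exact hmax i hi y hy'
    · rw [Function.update_self]
      exact hxmax y hy'

/-- Weighted singular value decomposition of a quaternion matrix. -/
theorem stmt1 {m n : ℕ} (A : Matrix (Fin m) (Fin n) ℍ[ℝ])
    (M : Matrix (Fin m) (Fin m) ℍ[ℝ]) (N Ninv : Matrix (Fin n) (Fin n) ℍ[ℝ])
    (hM : IsPosDef M) (hN : IsPosDef N)
    (hN1 : N * Ninv = 1) (hN2 : Ninv * N = 1) :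
    ∃ (U : Matrix (Fin m) (Fin m) ℍ[ℝ]) (V : Matrix (Fin n) (Fin n) ℍ[ℝ])
      (r : ℕ) (_ : r ≤ min m n) (σ : Fin r → ℝ),
      Uᴴ * M * U = 1 ∧ Vᴴ * Ninv * V = 1 ∧
      (∀ i j : Fin r, i ≤ j → σ j ≤ σ i) ∧ (∀ i, 0 < σ i) ∧
      A = U * (Matrix.of fun (i : Fin m) (j : Fin n) =>
        if h : (i : ℕ) = (j : ℕ) ∧ (i : ℕ) < r then ((σ ⟨i, h.2⟩ : ℝ) : ℍ[ℝ]) else 0) * Vᴴ := by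
  have hN' : IsPosDef Ninv := hN.inverse hN1
  let B := A * Ninv
  obtain ⟨v, hv, hmax⟩ := wform_exists_singular_vectors M hN' B n le_rfl
  let s : ℕ → ℝ := fun i => (wform M (B *ᵥ v i) (B *ᵥ v i)).re
  have hs_nonneg (i) : 0 ≤ s i := hM.wform_self_re_nonneg _
  have hs_anti {i j} (hij : i ≤ j) (hj : j < n) : s j ≤ s i := by
    have := hmax i (by omega) (v j) fun l hl => by
      rw [hv l (by omega) j hj, if_neg (by omega)]
    simpa [hv j hj j hj] using this
  have horth_lt {i j} (hij : i < j) (hj : j < n) : wform M (B *ᵥ v i) (B *ᵥ v j) = 0 := by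
    have hi : i < n := by omega
    refine wform_mulVec_eq_zero_of_max hM hN' B (by simp [hv i hi i hi])
      (by simp [hv i hi j hj, hij.ne]) fun q => hmax i hi _ fun l hl => ?_
    rw [wform_add_right, wform_op_smul_right, hv l (by omega) i hi, hv l (by omega) j hj,
      if_neg (by omega), if_neg (by omega), zero_mul, add_zero]
  have horth {i j} (hij : i ≠ j) (hi : i < n) (hj : j < n) :
      wform M (B *ᵥ v i) (B *ᵥ v j) = 0 := by
    rcases hij.lt_or_gt with h | h
    · exact horth_lt h hj
    · exact hM.wform_symm_zero (horth_lt h hi)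
  obtain ⟨r, hrn, hr_pos, hr_zero⟩ : ∃ r ≤ n, (∀ i < r, 0 < s i) ∧
      ∀ i, r ≤ i → i < n → B *ᵥ v i = 0 := by
    classical
    have hex : ∃ i, n ≤ i ∨ s i = 0 := ⟨n, Or.inl le_rfl⟩
    refine ⟨Nat.find hex, Nat.find_min' hex (Or.inl le_rfl), fun i hi => ?_,
      fun i hri hin => ?_⟩
    · have := Nat.find_min hex hi
      push Not at this
      exact (hs_nonneg i).lt_of_ne' this.2
    · by_contra h0
      have h1 := hM.wform_self_re_pos h0
      have h2 := hs_anti hri hin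
      rcases Nat.find_spec hex with h | h
      · omega
      · rw [h] at h2
        exact h1.not_ge h2
  have hu : ∀ i < r, ∀ j < r,
      wform M ((√(s i))⁻¹ • (B *ᵥ v i)) ((√(s j))⁻¹ • (B *ᵥ v j)) = if i = j then 1 else 0 := by
    intro i hi j hj
    split_ifs with hij
    · subst hij
      refine hM.wform_normalize fun h => (hr_pos i hi).ne' ?_
      simp [s, h, wform_zero_left]
    · rw [wform_smul_left, wform_smul_right, horth hij (by omega) (by omega), smul_zero,
        smul_zero]
  have hrm := le_of_wform_orthonormal M _ hu
  obtain ⟨u, hur, huo⟩ := wform_orthonormal_extend hM _ hu m hrm le_rfl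
  let U : Matrix (Fin m) (Fin m) ℍ[ℝ] := Matrix.of fun a i => u i a
  let V : Matrix (Fin n) (Fin n) ℍ[ℝ] := Matrix.of fun a i => v i a
  have hU : Uᴴ * M * U = 1 := by
    ext1 i j
    have := huo i i.2 j j.2
    simp only [wform, dotProduct, mulVec] at this
    rw [Matrix.mul_assoc]
    simpa [U, mul_apply, one_apply, Fin.ext_iff] using this
  have hV : Vᴴ * Ninv * V = 1 := by
    ext1 i j
    have := hv i i.2 j j.2
    simp only [wform, dotProduct, mulVec] at this
    rw [Matrix.mul_assoc]
    simpa [V, mul_apply, one_apply, Fin.ext_iff] using this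
  have hV' : V * Vᴴ = N := by
    have h := (mul_eq_one_comm_of_card_eq (Fin n) (Fin n) ℍ[ℝ] rfl).mp hV
    rw [← Matrix.mul_assoc] at h
    exact left_inv_eq_right_inv h hN2
  refine ⟨U, V, r, le_min hrm hrn, fun i => √(s i), hU, hV,
    fun i j hij => Real.sqrt_le_sqrt (hs_anti hij (by omega)),
    fun i => Real.sqrt_pos.mpr (hr_pos i i.2), ?_⟩
  have hBV : B * V = U * (Matrix.of fun (i : Fin m) (j : Fin n) =>
      if h : (i : ℕ) = (j : ℕ) ∧ (i : ℕ) < r then ((√(s i) : ℝ) : ℍ[ℝ]) else 0) := by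
    ext1 a j
    have hcol : (B * V) a j = (B *ᵥ v j) a := rfl
    rw [hcol, mul_apply]
    by_cases hj : (j : ℕ) < r
    · rw [Finset.sum_eq_single ⟨j, by omega⟩ _ (by simp)]
      · have hsq := Real.sqrt_pos.mpr (hr_pos j hj)
        simp [U, hj, hur j hj, ← Quaternion.coe_commutes, Quaternion.coe_mul_eq_smul,
          smul_smul, hsq.ne']
      · intro b _ hb
        have : (b : ℕ) ≠ j := fun h => hb (Fin.ext h)
        simp [this]
    · rw [hr_zero j (by omega) j.2, Finset.sum_eq_zero, Pi.zero_apply]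
      intro b _
      have : ¬ ((b : ℕ) = j ∧ (b : ℕ) < r) := by omega
      simp [this]
  rw [← hBV, Matrix.mul_assoc, hV', Matrix.mul_assoc, hN2, Matrix.mul_one]
end

section
/- Let A ∈ ℍ^{m×n}, let M ∈ ℍ^{m×m} and N ∈ ℍ^{n×n} be Hermitian positive definite, with N invertible with two-sided inverse N⁻¹. Suppose U ∈ ℍ^{m×m} and V ∈ ℍ^{n×n} satisfy Uᴴ M U = I_m, Vᴴ N⁻¹ V = I_n, and A = U D Vᴴ, where D ∈ ℍ^{m×n} has (i,i) entry σ_i for 1 ≤ i ≤ r with each σ_i a positive real number, and all other entries of D are zero. Let D† ∈ ℍ^{n×m} be the matrix with (i,i) entry σ_i⁻¹ for 1 ≤ i ≤ r and zeros elsewhere. Then X := N⁻¹ V D† Uᴴ M is the weighted Moore–Penrose inverse of A with weights M, N; that is, A X A = A, X A X = X, (M A X)ᴴ = M A X, and (N X A)ᴴ = N X A. -/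
open scoped Quaternion
open Matrix

/-- `X` is the weighted Moore–Penrose inverse of `A` with weights `M`, `N`. -/
def IsWMPInv {m n : ℕ} (M : Matrix (Fin m) (Fin m) ℍ[ℝ]) (N : Matrix (Fin n) (Fin n) ℍ[ℝ])
    (A : Matrix (Fin m) (Fin n) ℍ[ℝ]) (X : Matrix (Fin n) (Fin m) ℍ[ℝ]) : Prop :=
  A * X * A = A ∧ X * A * X = X ∧ (M * A * X)ᴴ = M * A * X ∧ (N * X * A)ᴴ = N * X * A

/-- The rectangular quaternion matrix with real diagonal entries `d 0, d 1, …`. -/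
noncomputable def rectDiagonal (m n : ℕ) (d : ℕ → ℝ) : Matrix (Fin m) (Fin n) ℍ[ℝ] :=
  fun i j => if (i : ℕ) = j then (d i : ℍ[ℝ]) else 0

theorem conjTranspose_rectDiagonal (m n : ℕ) (d : ℕ → ℝ) :
    (rectDiagonal m n d)ᴴ = rectDiagonal n m d := by
  ext1 i j
  by_cases h : (i : ℕ) = j
  · simp [rectDiagonal, conjTranspose_apply, h]
  · simp [rectDiagonal, conjTranspose_apply, h, Ne.symm h]

theorem rectDiagonal_mul_rectDiagonal (m n k : ℕ) (d e : ℕ → ℝ) :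
    rectDiagonal m n d * rectDiagonal n k e =
      rectDiagonal m k fun i => if i < n then d i * e i else 0 := by
  ext1 i j
  rw [mul_apply]
  by_cases hi : (i : ℕ) < n
  · rw [Finset.sum_eq_single ⟨i, hi⟩]
    · simp [rectDiagonal, hi]
    · intro l _ hl
      have : (i : ℕ) ≠ l := fun h => hl (Fin.ext h.symm)
      simp [rectDiagonal, this]
    · simp
  · rw [Finset.sum_eq_zero]
    · simp [rectDiagonal, hi]
    · intro l _
      have : (i : ℕ) ≠ l := fun h => hi (h ▸ l.isLt)
      simp [rectDiagonal, this]

theorem rectDiagonal_mul_mul_cancel (m n : ℕ) {d e : ℕ → ℝ} (h : ∀ i, d i * e i * d i = d i) :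
    rectDiagonal m n d * rectDiagonal n m e * rectDiagonal m n d = rectDiagonal m n d := by
  rw [rectDiagonal_mul_rectDiagonal, rectDiagonal_mul_rectDiagonal]
  ext1 i j
  by_cases hij : (i : ℕ) = j
  · have hi : (i : ℕ) < n := hij ▸ j.isLt
    simp only [rectDiagonal, if_pos hij, if_pos hi, if_pos i.isLt, h]
  · simp [rectDiagonal, hij]

theorem conjTranspose_rectDiagonal_mul_rectDiagonal (m n : ℕ) (d e : ℕ → ℝ) :
    (rectDiagonal m n d * rectDiagonal n m e)ᴴ = rectDiagonal m n d * rectDiagonal n m e := by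
  rw [rectDiagonal_mul_rectDiagonal, conjTranspose_rectDiagonal]

/-- The weighted Moore–Penrose inverse expressed via the weighted SVD. -/
theorem stmt2 {m n r : ℕ} (A : Matrix (Fin m) (Fin n) ℍ[ℝ])
    (M : Matrix (Fin m) (Fin m) ℍ[ℝ]) (N Ninv : Matrix (Fin n) (Fin n) ℍ[ℝ])
    (hM : IsPosDef M) (hN : IsPosDef N)
    (hN1 : N * Ninv = 1) (hN2 : Ninv * N = 1)
    (U : Matrix (Fin m) (Fin m) ℍ[ℝ]) (V : Matrix (Fin n) (Fin n) ℍ[ℝ])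
    (σ : Fin r → ℝ) (hσ : ∀ i, 0 < σ i)
    (D : Matrix (Fin m) (Fin n) ℍ[ℝ])
    (hD : ∀ i j, D i j =
      if h : (i : ℕ) = (j : ℕ) ∧ (i : ℕ) < r then ((σ ⟨i, h.2⟩ : ℝ) : ℍ[ℝ]) else 0)
    (Ddag : Matrix (Fin n) (Fin m) ℍ[ℝ])
    (hDdag : ∀ i j, Ddag i j =
      if h : (i : ℕ) = (j : ℕ) ∧ (i : ℕ) < r then (((σ ⟨i, h.2⟩)⁻¹ : ℝ) : ℍ[ℝ]) else 0)
    (hU : Uᴴ * M * U = 1) (hV : Vᴴ * Ninv * V = 1)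
    (hA : A = U * D * Vᴴ) :
    IsWMPInv M N A (Ninv * V * Ddag * Uᴴ * M) := by
  let d : ℕ → ℝ := fun i => if h : i < r then σ ⟨i, h⟩ else 0
  have hd : D = rectDiagonal m n d := by
    ext1 i j
    rw [hD]
    by_cases hij : (i : ℕ) = j
    · by_cases hi : (i : ℕ) < r
      · rw [dif_pos ⟨hij, hi⟩]
        simp only [rectDiagonal, d, if_pos hij, dif_pos hi]
      · simp [rectDiagonal, d, hi]
    · simp [rectDiagonal, hij]
  have he : Ddag = rectDiagonal n m fun i => (d i)⁻¹ := by
    ext1 i j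
    rw [hDdag]
    by_cases hij : (i : ℕ) = j
    · by_cases hi : (i : ℕ) < r
      · rw [dif_pos ⟨hij, hi⟩]
        simp only [rectDiagonal, d, if_pos hij, dif_pos hi]
      · simp [rectDiagonal, d, hi]
    · simp [rectDiagonal, hij]
  have hDD : D * Ddag * D = D := by
    rw [hd, he]
    exact rectDiagonal_mul_mul_cancel m n fun i => mul_inv_mul_cancel (d i)
  have hEE : Ddag * D * Ddag = Ddag := by
    rw [hd, he]
    exact rectDiagonal_mul_mul_cancel n m fun i => by
      simpa using mul_inv_mul_cancel (d i)⁻¹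
  have hDE : (D * Ddag)ᴴ = D * Ddag := by
    rw [hd, he]
    exact conjTranspose_rectDiagonal_mul_rectDiagonal m n _ _
  have hED : (Ddag * D)ᴴ = Ddag * D := by
    rw [hd, he]
    exact conjTranspose_rectDiagonal_mul_rectDiagonal n m _ _
  have hAX : A * (Ninv * V * Ddag * Uᴴ * M) = U * (D * Ddag) * Uᴴ * M := by
    calc _ = U * D * (Vᴴ * Ninv * V) * Ddag * Uᴴ * M := by simp only [hA, Matrix.mul_assoc]
      _ = _ := by rw [hV, Matrix.mul_one]; simp only [Matrix.mul_assoc]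
  have hXA : Ninv * V * Ddag * Uᴴ * M * A = Ninv * V * (Ddag * D) * Vᴴ := by
    calc _ = Ninv * V * Ddag * (Uᴴ * M * U) * D * Vᴴ := by simp only [hA, Matrix.mul_assoc]
      _ = _ := by rw [hU, Matrix.mul_one]; simp only [Matrix.mul_assoc]
  refine ⟨?_, ?_, ?_, ?_⟩
  · rw [hAX]
    calc _ = U * (D * Ddag) * (Uᴴ * M * U) * D * Vᴴ := by simp only [hA, Matrix.mul_assoc]
      _ = U * (D * Ddag * D) * Vᴴ := by rw [hU, Matrix.mul_one]; simp only [Matrix.mul_assoc]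
      _ = A := by rw [hDD, hA]
  · rw [hXA]
    calc _ = Ninv * V * (Ddag * D) * (Vᴴ * Ninv * V) * Ddag * Uᴴ * M := by
          simp only [Matrix.mul_assoc]
      _ = Ninv * V * (Ddag * D * Ddag) * Uᴴ * M := by
          rw [hV, Matrix.mul_one]; simp only [Matrix.mul_assoc]
      _ = _ := by rw [hEE]
  · rw [Matrix.mul_assoc M A, hAX]
    have h : M * (U * (D * Ddag) * Uᴴ * M) = M * U * (D * Ddag) * (M * U)ᴴ := by
      rw [conjTranspose_mul, hM.1]
      simp only [Matrix.mul_assoc]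
    rw [h]
    exact isHermitian_mul_mul_conjTranspose _ hDE
  · rw [Matrix.mul_assoc N, hXA]
    have h : N * (Ninv * V * (Ddag * D) * Vᴴ) = V * (Ddag * D) * Vᴴ := by
      simp only [← Matrix.mul_assoc, hN1, Matrix.one_mul]
    rw [h]
    exact isHermitian_mul_mul_conjTranspose _ hED
end

section
/- Let A ∈ ℍ^{m×n}, let M ∈ ℍ^{m×m} and N ∈ ℍ^{n×n} be Hermitian positive definite with N invertible, set A^♯ := N⁻¹ Aᴴ M, and let X be the weighted Moore–Penrose inverse of A with weights M, N. Then for every real λ > 0 the matrix λ·I_n + A^♯A is invertible in the ring of n×n quaternion matrices, and the matrix-valued function λ ↦ (λ·I_n + A^♯A)⁻¹ A^♯ converges (entrywise, in the standard topology of ℍ) to X as λ tends to 0 through positive real values. -/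
open scoped Quaternion
open Matrix

/-- A square quaternion matrix with trivial kernel is a unit. -/
theorem isUnit_of_mulVec_eq_zero {k : ℕ} (T : Matrix (Fin k) (Fin k) ℍ[ℝ])
    (h : ∀ x : Fin k → ℍ[ℝ], T.mulVec x = 0 → x = 0) : IsUnit T := by
  have hker : ∀ Y : Matrix (Fin k) (Fin k) ℍ[ℝ], T * Y = 0 → Y = 0 := by
    intro Y hY
    ext1 i j
    have hcol : T.mulVec (fun i => Y i j) = 0 := by
      funext i
      exact congrFun (congrFun hY i) j
    exact congrFun (h _ hcol) i
  have hinj : Function.Injective (LinearMap.mulLeft ℝ T) :=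
    (injective_iff_map_eq_zero _).2 fun Y hY => hker Y hY
  obtain ⟨U, hU⟩ := LinearMap.surjective_of_injective hinj 1
  have hTU : T * U = 1 := hU
  have hUT : U * T = 1 := by
    refine sub_eq_zero.1 (hker _ ?_)
    rw [mul_sub, ← mul_assoc, hTU, one_mul, mul_one, sub_self]
  exact ⟨⟨T, U, hTU, hUT⟩, rfl⟩

theorem IsPosDef.isUnit {k : ℕ} {M : Matrix (Fin k) (Fin k) ℍ[ℝ]} (hM : IsPosDef M) :
    IsUnit M := by
  refine isUnit_of_mulVec_eq_zero M fun x hx => ?_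
  by_contra hne
  obtain ⟨r, hr, h⟩ := hM.2 x hne
  rw [hx, dotProduct_zero] at h
  exact hr.ne (Quaternion.coe_injective (by simpa using h))

theorem IsPosDef.exists_nonneg {k : ℕ} {M : Matrix (Fin k) (Fin k) ℍ[ℝ]} (hM : IsPosDef M)
    (x : Fin k → ℍ[ℝ]) : ∃ r : ℝ, 0 ≤ r ∧ star x ⬝ᵥ M.mulVec x = (r : ℍ[ℝ]) := by
  by_cases hx : x = 0
  · exact ⟨0, le_rfl, by simp [hx]⟩
  · obtain ⟨r, hr, h⟩ := hM.2 x hx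
    exact ⟨r, hr.le, h⟩

/-- A positive multiple of a positive definite matrix plus a Gram matrix is a unit. -/
theorem IsPosDef.isUnit_smul_add {m n : ℕ} {M : Matrix (Fin m) (Fin m) ℍ[ℝ]}
    {N : Matrix (Fin n) (Fin n) ℍ[ℝ]} (hM : IsPosDef M) (hN : IsPosDef N)
    (A : Matrix (Fin m) (Fin n) ℍ[ℝ]) {l : ℝ} (hl : 0 < l) :
    IsUnit (l • N + Aᴴ * M * A) := by
  refine isUnit_of_mulVec_eq_zero _ fun x hx => ?_
  by_contra hne
  obtain ⟨r, hr, h⟩ := hN.2 x hne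
  obtain ⟨s, hs, h'⟩ := hM.exists_nonneg (A.mulVec x)
  have hA : star x ⬝ᵥ (Aᴴ * M * A).mulVec x = (s : ℍ[ℝ]) := by
    rw [← h', star_mulVec, ← dotProduct_mulVec, mulVec_mulVec, mulVec_mulVec, Matrix.mul_assoc]
  have hsum : star x ⬝ᵥ (l • N + Aᴴ * M * A).mulVec x = ((l * r + s : ℝ) : ℍ[ℝ]) := by
    rw [add_mulVec, dotProduct_add, hA, smul_mulVec, dotProduct_smul, h]
    ext <;> simp
  rw [hx, dotProduct_zero] at hsum
  have h0 : (0 : ℝ) = l * r + s := Quaternion.coe_injective (by simpa using hsum)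
  nlinarith [mul_pos hl hr]

section
attribute [local instance] Matrix.linftyOpNormedRing Matrix.linftyOpNormedAlgebra

/-- For small real `l` the matrix `1 + l W` is a unit, and its inverse tends to `1`. -/
theorem tendsto_smul_mul_inverse {m n : ℕ} (W : Matrix (Fin m) (Fin m) ℍ[ℝ])
    (Z : Matrix (Fin n) (Fin m) ℍ[ℝ]) :
    (∀ᶠ l : ℝ in nhds 0, IsUnit (1 + l • W)) ∧
      Filter.Tendsto (fun l : ℝ => l • (Z * Ring.inverse (1 + l • W))) (nhds 0) (nhds 0) := by
  have hc : Filter.Tendsto (fun l : ℝ => 1 + l • W) (nhds 0) (nhds 1) := by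
    have : Continuous (fun l : ℝ => 1 + l • W) := by fun_prop
    simpa using this.tendsto 0
  refine ⟨hc (Units.isOpen.mem_nhds isUnit_one), ?_⟩
  have hi : Filter.Tendsto (fun l : ℝ => Ring.inverse (1 + l • W)) (nhds 0) (nhds 1) := by
    have := (NormedRing.inverse_continuousAt (1 : (Matrix (Fin m) (Fin m) ℍ[ℝ])ˣ)).tendsto
    rw [Units.val_one, Ring.inverse_one] at this
    exact this.comp hc
  have hm : Continuous (fun V : Matrix (Fin m) (Fin m) ℍ[ℝ] => Z * V) :=
    continuous_const.matrix_mul continuous_id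
  have := Filter.Tendsto.smul (Filter.tendsto_id (α := ℝ) (x := nhds 0)) ((hm.tendsto 1).comp hi)
  simpa using this

end

/-- The normal equation `A♯ A X = A♯`. -/
theorem IsWMPInv.normal_equation {m n : ℕ} {M : Matrix (Fin m) (Fin m) ℍ[ℝ]}
    {N : Matrix (Fin n) (Fin n) ℍ[ℝ]} {A : Matrix (Fin m) (Fin n) ℍ[ℝ]}
    {X : Matrix (Fin n) (Fin m) ℍ[ℝ]} (hX : IsWMPInv M N A X) (hM : Mᴴ = M) :
    Aᴴ * M * A * X = Aᴴ * M := by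
  have h := hX.2.2.1
  have h1 := congrArg conjTranspose hX.1
  simp only [conjTranspose_mul, hM] at h h1
  calc Aᴴ * M * A * X = Aᴴ * (M * A * X) := by simp only [Matrix.mul_assoc]
    _ = Aᴴ * (Xᴴ * Aᴴ) * M := by rw [← h]; simp only [Matrix.mul_assoc]
    _ = Aᴴ * M := by rw [h1]

/-- The columns of `X` lie in the range of `A♯`. -/
theorem IsWMPInv.exists_factor {m n : ℕ} {M : Matrix (Fin m) (Fin m) ℍ[ℝ]}
    {N Ninv : Matrix (Fin n) (Fin n) ℍ[ℝ]} {A : Matrix (Fin m) (Fin n) ℍ[ℝ]}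
    {X : Matrix (Fin n) (Fin m) ℍ[ℝ]} (hX : IsWMPInv M N A X) (hM : IsUnit M) (hN : Nᴴ = N)
    (hN2 : Ninv * N = 1) :
    ∃ W : Matrix (Fin m) (Fin m) ℍ[ℝ], X = Ninv * Aᴴ * M * W := by
  obtain ⟨Minv, hMinv⟩ := hM.exists_right_inv
  have h := hX.2.2.2
  simp only [conjTranspose_mul, hN] at h
  refine ⟨Minv * (Xᴴ * N * X), ?_⟩
  calc X = Ninv * N * (X * A * X) := by rw [hN2, hX.2.1, Matrix.one_mul]
    _ = Ninv * (N * X * A) * X := by simp only [Matrix.mul_assoc]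
    _ = Ninv * Aᴴ * (M * Minv) * (Xᴴ * N * X) := by
      rw [← h, hMinv, Matrix.mul_one]; simp only [Matrix.mul_assoc]
    _ = _ := by simp only [Matrix.mul_assoc]

/-- Limit representation `A⁺_{M,N} = lim_{λ→0⁺} (λI + A♯A)⁻¹ A♯` where `A♯ = N⁻¹ Aᴴ M`. -/
theorem stmt3 {m n : ℕ} (A : Matrix (Fin m) (Fin n) ℍ[ℝ])
    (M : Matrix (Fin m) (Fin m) ℍ[ℝ]) (N Ninv : Matrix (Fin n) (Fin n) ℍ[ℝ])
    (hM : IsPosDef M) (hN : IsPosDef N)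
    (hN1 : N * Ninv = 1) (hN2 : Ninv * N = 1)
    (X : Matrix (Fin n) (Fin m) ℍ[ℝ]) (hX : IsWMPInv M N A X) :
    (∀ l : ℝ, 0 < l →
      IsUnit (l • (1 : Matrix (Fin n) (Fin n) ℍ[ℝ]) + (Ninv * Aᴴ * M) * A)) ∧
    ∀ i j, Filter.Tendsto
      (fun l : ℝ =>
        (Ring.inverse (l • (1 : Matrix (Fin n) (Fin n) ℍ[ℝ]) + (Ninv * Aᴴ * M) * A) *
          (Ninv * Aᴴ * M)) i j)
      (nhdsWithin 0 (Set.Ioi 0)) (nhds (X i j)) := by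
  have hu : ∀ l : ℝ, 0 < l →
      IsUnit (l • (1 : Matrix (Fin n) (Fin n) ℍ[ℝ]) + (Ninv * Aᴴ * M) * A) := by
    intro l hl
    have h := (show IsUnit Ninv from ⟨⟨Ninv, N, hN2, hN1⟩, rfl⟩).mul (hM.isUnit_smul_add hN A hl)
    rwa [mul_add, mul_smul_comm, hN2, ← Matrix.mul_assoc, ← Matrix.mul_assoc] at h
  refine ⟨hu, ?_⟩
  obtain ⟨W, hW⟩ := hX.exists_factor hM.isUnit hN.1 hN2
  have hS : Ninv * Aᴴ * M * A * X = Ninv * Aᴴ * M := by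
    have h := congrArg (Ninv * ·) (hX.normal_equation hM.1)
    simpa only [Matrix.mul_assoc] using h
  set S := Ninv * Aᴴ * M
  obtain ⟨hunit, hlim⟩ := tendsto_smul_mul_inverse W (X * W)
  have hev : ∀ᶠ l : ℝ in nhdsWithin 0 (Set.Ioi 0),
      X - l • (X * W * Ring.inverse (1 + l • W)) =
        Ring.inverse (l • (1 : Matrix (Fin n) (Fin n) ℍ[ℝ]) + S * A) * S := by
    filter_upwards [self_mem_nhdsWithin, nhdsWithin_le_nhds hunit] with l hl hl'
    have hT := Ring.inverse_mul_cancel _ (hu l hl)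
    have hV := Ring.mul_inverse_cancel _ hl'
    set U := Ring.inverse (l • (1 : Matrix (Fin n) (Fin n) ℍ[ℝ]) + S * A)
    set V := Ring.inverse (1 + l • W)
    have hUS : U * S = X - l • (U * X) := by
      have h := congrArg (· * X) hT
      simp only [Matrix.mul_add, Matrix.add_mul, Matrix.mul_smul, Matrix.smul_mul,
        Matrix.mul_one, Matrix.one_mul, Matrix.mul_assoc U, hS] at h
      exact eq_sub_of_add_eq' h
    have hUX : U * X = X * W - l • (U * X * W) := by
      calc U * X = U * S * W := by rw [Matrix.mul_assoc, ← hW]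
        _ = _ := by rw [hUS, Matrix.sub_mul, Matrix.smul_mul]
    have hUV : U * X = X * W * V := by
      have h : U * X * (1 + l • W) = X * W := by
        rw [Matrix.mul_add, Matrix.mul_one, Matrix.mul_smul]
        exact add_eq_of_eq_sub hUX
      rw [← h, Matrix.mul_assoc, hV, Matrix.mul_one]
    rw [hUS, hUV]
  have hfin := ((tendsto_const_nhds (x := X)).sub
    (hlim.mono_left nhdsWithin_le_nhds)).congr' hev
  rw [sub_zero] at hfin
  intro i j
  exact tendsto_pi_nhds.1 (tendsto_pi_nhds.1 hfin i) j
end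

section
/- Let A ∈ ℍ^{m×n}, let M ∈ ℍ^{m×m} and N ∈ ℍ^{n×n} be Hermitian positive definite with N invertible, set A^♯ := N⁻¹ Aᴴ M, and let X be the weighted Moore–Penrose inverse of A with weights M, N. Then for every real λ > 0 the matrix λ·I_m + A A^♯ is invertible in the ring of m×m quaternion matrices, and the matrix-valued function λ ↦ A^♯ (λ·I_m + A A^♯)⁻¹ converges (entrywise, in the standard topology of ℍ) to X as λ tends to 0 through positive real values. -/
open scoped Quaternion
open Matrix

theorem isUnit_of_forall_mulVec_eq_zero {k : ℕ} (L : Matrix (Fin k) (Fin k) ℍ[ℝ])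
    (h : ∀ x, L.mulVec x = 0 → x = 0) : IsUnit L := by
  have hinj : Function.Injective (LinearMap.mulLeft ℝ L) := by
    rw [injective_iff_map_eq_zero]
    intro Y hY
    have hcol : ∀ j, (fun i => Y i j) = 0 := fun j =>
      h _ (funext fun i => congrFun (congrFun hY i) j)
    ext1 i j
    exact congrFun (hcol j) i
  obtain ⟨R, hR⟩ := LinearMap.injective_iff_surjective.mp hinj 1
  have hR : L * R = 1 := hR
  have hR' : R * L = 1 := hinj <| by
    simp only [LinearMap.mulLeft_apply, ← mul_assoc, hR, one_mul, mul_one]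
  exact ⟨⟨L, R, hR, hR'⟩, rfl⟩

theorem conjTranspose_eq_of_mul_eq_one {k : ℕ} {N Ninv : Matrix (Fin k) (Fin k) ℍ[ℝ]}
    (hN : Nᴴ = N) (h : N * Ninv = 1) : Ninvᴴ = Ninv := by
  have h1 : Ninvᴴ * N = 1 := by
    calc Ninvᴴ * N = (N * Ninv)ᴴ := by rw [conjTranspose_mul, hN]
      _ = 1 := by rw [h, conjTranspose_one]
  exact left_inv_eq_right_inv h1 h

theorem isUnit_smul_one_add_mul {m n : ℕ} (A : Matrix (Fin m) (Fin n) ℍ[ℝ])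
    {M : Matrix (Fin m) (Fin m) ℍ[ℝ]} {N Ninv : Matrix (Fin n) (Fin n) ℍ[ℝ]}
    (hM : IsPosDef M) (hN : IsPosDef N) (hN1 : N * Ninv = 1) (hN2 : Ninv * N = 1)
    {l : ℝ} (hl : 0 < l) :
    IsUnit (l • (1 : Matrix (Fin m) (Fin m) ℍ[ℝ]) + A * (Ninv * Aᴴ * M)) := by
  refine isUnit_of_forall_mulVec_eq_zero _ fun x hx => ?_
  by_contra hne
  obtain ⟨r, hr, h⟩ := hM.2 x hne
  obtain ⟨s, hs, h'⟩ := hN.exists_nonneg ((Ninv * Aᴴ * M).mulVec x)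
  have hNinv := conjTranspose_eq_of_mul_eq_one hN.1 hN1
  have hadj : (Ninv * Aᴴ * M)ᴴ * (N * (Ninv * Aᴴ * M)) = M * (A * (Ninv * Aᴴ * M)) := by
    simp only [conjTranspose_mul, conjTranspose_conjTranspose, hM.1, hNinv, Matrix.mul_assoc]
    rw [← Matrix.mul_assoc Ninv N, hN2, Matrix.one_mul]
  have hquad : star x ⬝ᵥ M.mulVec ((A * (Ninv * Aᴴ * M)).mulVec x) = (s : ℍ[ℝ]) := by
    rw [← h', star_mulVec, ← dotProduct_mulVec, mulVec_mulVec, mulVec_mulVec, mulVec_mulVec,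
      Matrix.mul_assoc _ N, hadj]
  have hsum : star x ⬝ᵥ M.mulVec
      ((l • (1 : Matrix (Fin m) (Fin m) ℍ[ℝ]) + A * (Ninv * Aᴴ * M)).mulVec x)
      = ((l * r + s : ℝ) : ℍ[ℝ]) := by
    rw [add_mulVec, mulVec_add, dotProduct_add, hquad, smul_mulVec, one_mulVec, mulVec_smul,
      dotProduct_smul, h]
    ext <;> simp
  rw [hx, mulVec_zero, dotProduct_zero] at hsum
  have hzero : l * r + s = 0 := Quaternion.coe_injective (by simpa using hsum.symm)
  nlinarith [mul_pos hl hr]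

theorem IsWMPInv.exists_one_add_smul_mul_eq {m n : ℕ} {A : Matrix (Fin m) (Fin n) ℍ[ℝ]}
    {M : Matrix (Fin m) (Fin m) ℍ[ℝ]} {N Ninv : Matrix (Fin n) (Fin n) ℍ[ℝ]}
    {X : Matrix (Fin n) (Fin m) ℍ[ℝ]} (hX : IsWMPInv M N A X)
    (hM : IsPosDef M) (hN : IsPosDef N) (hN1 : N * Ninv = 1) (hN2 : Ninv * N = 1) :
    ∃ G : Matrix (Fin n) (Fin n) ℍ[ℝ], ∀ l : ℝ,
      (1 + l • G) * (Ninv * Aᴴ * M) =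
        X * (l • (1 : Matrix (Fin m) (Fin m) ℍ[ℝ]) + A * (Ninv * Aᴴ * M)) := by
  obtain ⟨hAXA, hXAX, hMAX, hNXA⟩ := hX
  obtain ⟨Minv, hMinv⟩ := hM.isUnit.exists_left_inv
  simp only [conjTranspose_mul, hM.1, hN.1] at hMAX hNXA
  have hXA : X * A * Ninv = Ninv * (Aᴴ * Xᴴ) := by
    calc X * A * Ninv = Ninv * (N * X * A) * Ninv := by
          simp only [← Matrix.mul_assoc, hN2, Matrix.one_mul]
      _ = Ninv * (Aᴴ * Xᴴ) := by
          rw [← hNXA]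
          simp only [Matrix.mul_assoc, hN1, Matrix.mul_one]
  have hXB : X * (A * (Ninv * Aᴴ * M)) = Ninv * Aᴴ * M := by
    calc X * (A * (Ninv * Aᴴ * M)) = X * A * Ninv * Aᴴ * M := by simp only [Matrix.mul_assoc]
      _ = Ninv * (A * X * A)ᴴ * M := by
          rw [hXA]
          simp only [conjTranspose_mul, Matrix.mul_assoc]
      _ = Ninv * Aᴴ * M := by rw [hAXA]
  have hGA : X * Minv * Xᴴ * N * (Ninv * Aᴴ * M) = X := by
    calc X * Minv * Xᴴ * N * (Ninv * Aᴴ * M)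
        = X * Minv * Xᴴ * (N * Ninv) * Aᴴ * M := by simp only [Matrix.mul_assoc]
      _ = X * Minv * (Xᴴ * (Aᴴ * M)) := by
          rw [hN1]
          simp only [Matrix.mul_assoc, Matrix.one_mul]
      _ = X * (Minv * M) * A * X := by
          rw [hMAX]
          simp only [Matrix.mul_assoc]
      _ = X := by rw [hMinv, Matrix.mul_one, hXAX]
  refine ⟨X * Minv * Xᴴ * N, fun l => ?_⟩
  rw [Matrix.add_mul, Matrix.mul_add, Matrix.one_mul, smul_mul, hGA, hXB, Matrix.mul_smul,
    Matrix.mul_one, add_comm]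

theorem tendsto_inverse_one_add_smul_mul {m n : ℕ} (G : Matrix (Fin n) (Fin n) ℍ[ℝ])
    (X : Matrix (Fin n) (Fin m) ℍ[ℝ]) :
    (∀ᶠ l : ℝ in nhds 0, IsUnit (1 + l • G)) ∧
      Filter.Tendsto (fun l : ℝ => Ring.inverse (1 + l • G) * X) (nhds 0) (nhds X) := by
  let _ : NormedRing (Matrix (Fin n) (Fin n) ℍ[ℝ]) := Matrix.linftyOpNormedRing
  let _ : NormedAlgebra ℝ (Matrix (Fin n) (Fin n) ℍ[ℝ]) := Matrix.linftyOpNormedAlgebra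
  have hG : Filter.Tendsto (fun l : ℝ => 1 + l • G) (nhds 0) (nhds 1) := by
    have hcont : Continuous fun l : ℝ => 1 + l • G := by fun_prop
    have h := hcont.tendsto 0
    rwa [zero_smul, add_zero] at h
  have hcomplete : CompleteSpace (Matrix (Fin n) (Fin n) ℍ[ℝ]) := FiniteDimensional.complete ℝ _
  refine ⟨hG.eventually (Units.isOpen.mem_nhds isUnit_one), ?_⟩
  have hinv : Filter.Tendsto (fun l : ℝ => Ring.inverse (1 + l • G)) (nhds 0) (nhds 1) := by
    have h := NormedRing.inverse_continuousAt (1 : (Matrix (Fin n) (Fin n) ℍ[ℝ])ˣ)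
    have h' := h.tendsto.comp (f := fun l : ℝ => 1 + l • G) hG
    rw [Units.val_one, Ring.inverse_one] at h'
    exact h'
  have hmul : Continuous fun Y : Matrix (Fin n) (Fin n) ℍ[ℝ] => Y * X :=
    continuous_id.matrix_mul continuous_const
  simpa [Function.comp_def] using (hmul.tendsto 1).comp hinv

/-- Limit representation `A⁺_{M,N} = lim_{λ→0⁺} A♯ (λI + AA♯)⁻¹` where `A♯ = N⁻¹ Aᴴ M`. -/
theorem stmt4 {m n : ℕ} (A : Matrix (Fin m) (Fin n) ℍ[ℝ])
    (M : Matrix (Fin m) (Fin m) ℍ[ℝ]) (N Ninv : Matrix (Fin n) (Fin n) ℍ[ℝ])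
    (hM : IsPosDef M) (hN : IsPosDef N)
    (hN1 : N * Ninv = 1) (hN2 : Ninv * N = 1)
    (X : Matrix (Fin n) (Fin m) ℍ[ℝ]) (hX : IsWMPInv M N A X) :
    (∀ l : ℝ, 0 < l →
      IsUnit (l • (1 : Matrix (Fin m) (Fin m) ℍ[ℝ]) + A * (Ninv * Aᴴ * M))) ∧
    ∀ i j, Filter.Tendsto
      (fun l : ℝ =>
        ((Ninv * Aᴴ * M) *
          Ring.inverse (l • (1 : Matrix (Fin m) (Fin m) ℍ[ℝ]) + A * (Ninv * Aᴴ * M))) i j)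
      (nhdsWithin 0 (Set.Ioi 0)) (nhds (X i j)) := by
  have hunit := fun (l : ℝ) (hl : 0 < l) => isUnit_smul_one_add_mul A hM hN hN1 hN2 hl
  refine ⟨hunit, fun i j => ?_⟩
  obtain ⟨G, hG⟩ := hX.exists_one_add_smul_mul_eq hM hN hN1 hN2
  obtain ⟨hGunit, hlim⟩ := tendsto_inverse_one_add_smul_mul G X
  have hentry := (((continuous_id.matrix_elem i j).tendsto X).comp hlim).mono_left
    (nhdsWithin_le_nhds (s := Set.Ioi 0))
  refine hentry.congr' ?_
  filter_upwards [self_mem_nhdsWithin, nhdsWithin_le_nhds hGunit] with l hl hl'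
  have hfactor : Ring.inverse (1 + l • G) * X = Ninv * Aᴴ * M *
      Ring.inverse (l • (1 : Matrix (Fin m) (Fin m) ℍ[ℝ]) + A * (Ninv * Aᴴ * M)) := by
    calc Ring.inverse (1 + l • G) * X
        = Ring.inverse (1 + l • G) * (X * (l • 1 + A * (Ninv * Aᴴ * M)) *
            Ring.inverse (l • 1 + A * (Ninv * Aᴴ * M))) := by
          rw [Matrix.mul_assoc X, Ring.mul_inverse_cancel _ (hunit l hl), Matrix.mul_one]
      _ = Ring.inverse (1 + l • G) * (1 + l • G) * (Ninv * Aᴴ * M) *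
            Ring.inverse (l • 1 + A * (Ninv * Aᴴ * M)) := by
          rw [← hG]
          simp only [Matrix.mul_assoc]
      _ = _ := by rw [Ring.inverse_mul_cancel _ hl', Matrix.one_mul]
  exact congrFun (congrFun hfactor i) j
end

section
/- Let A ∈ ℍ^{m×n}, let M ∈ ℍ^{m×m} and N ∈ ℍ^{n×n} be Hermitian positive definite with N invertible with two-sided inverse N⁻¹. If the map x ↦ A x from ℍⁿ to ℍᵐ is surjective (i.e., A has full row rank m), then A N⁻¹ Aᴴ is invertible in the ring of m×m quaternion matrices and N⁻¹ Aᴴ (A N⁻¹ Aᴴ)⁻¹ is the weighted Moore–Penrose inverse of A with weights M, N. -/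
open scoped Quaternion
open Matrix

/-- A matrix `A` with surjective `x ↦ A x` has a right inverse. -/
theorem exists_mul_eq_one_of_surjective_mulVec {R : Type*} [Semiring R] {m n : ℕ}
    {A : Matrix (Fin m) (Fin n) R} (hA : Function.Surjective A.mulVec) :
    ∃ B : Matrix (Fin n) (Fin m) R, A * B = 1 := by
  choose f hf using hA
  refine ⟨Matrix.of fun i j => f (Pi.single j 1) i, ?_⟩
  ext i j
  have h := congrFun (hf (Pi.single j 1)) i
  rw [Matrix.one_apply, ← Pi.single_apply, ← h]
  rfl

theorem IsPosDef.eq_zero_of_conjTranspose_mul_mul {k l : ℕ} {N : Matrix (Fin k) (Fin k) ℍ[ℝ]}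
    (hN : IsPosDef N) {Y : Matrix (Fin k) (Fin l) ℍ[ℝ]} (hY : Yᴴ * N * Y = 0) : Y = 0 := by
  have hcol : ∀ j, (fun i => Y i j) = 0 := by
    intro j
    by_contra hne
    obtain ⟨r, hr, h⟩ := hN.2 _ hne
    have h0 : star (fun i => Y i j) ⬝ᵥ N.mulVec (fun i => Y i j) = 0 := by
      have h1 := congrFun (congrFun hY j) j
      rw [Matrix.mul_assoc] at h1
      exact h1
    rw [h0] at h
    exact hr.ne (congrArg QuaternionAlgebra.re h)
  ext1 i j
  exact congrFun (hcol j) i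

/-- In a finite-dimensional real algebra, an element that is not a left zero divisor has a
right inverse. -/
theorem exists_mul_eq_one_of_mul_eq_zero {R : Type*} [Ring R] [Algebra ℝ R]
    [FiniteDimensional ℝ R] {a : R} (ha : ∀ b, a * b = 0 → b = 0) : ∃ b, a * b = 1 :=
  LinearMap.injective_iff_surjective.mp
    ((injective_iff_map_eq_zero (LinearMap.mulLeft ℝ a)).mpr ha) 1

/-- Full row rank case: `A⁺_{M,N} = N⁻¹ Aᴴ (A N⁻¹ Aᴴ)⁻¹`. -/
theorem stmt10 {m n : ℕ} (A : Matrix (Fin m) (Fin n) ℍ[ℝ])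
    (M : Matrix (Fin m) (Fin m) ℍ[ℝ]) (N Ninv : Matrix (Fin n) (Fin n) ℍ[ℝ])
    (hM : IsPosDef M) (hN : IsPosDef N)
    (hN1 : N * Ninv = 1) (hN2 : Ninv * N = 1)
    (hsurj : Function.Surjective A.mulVec) :
    IsUnit (A * Ninv * Aᴴ) ∧
    IsWMPInv M N A ((Ninv * Aᴴ) * Ring.inverse (A * Ninv * Aᴴ)) := by
  obtain ⟨B, hB⟩ := exists_mul_eq_one_of_surjective_mulVec hsurj
  have hNinv : Ninvᴴ = Ninv := by
    have h : Ninvᴴ * N = 1 := by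
      rw [← hN.1, ← conjTranspose_mul, hN1, conjTranspose_one]
    exact left_inv_eq_right_inv h hN1
  have hBA : Bᴴ * Aᴴ = 1 := by rw [← conjTranspose_mul, hB, conjTranspose_one]
  have hGH : (A * Ninv * Aᴴ)ᴴ = A * Ninv * Aᴴ := by
    simp only [conjTranspose_mul, conjTranspose_conjTranspose, hNinv, Matrix.mul_assoc]
  have hNN : ∀ Z : Matrix (Fin n) (Fin m) ℍ[ℝ], N * (Ninv * Z) = Z := fun Z => by
    rw [← Matrix.mul_assoc, hN1, Matrix.one_mul]
  have hG0 : ∀ C, A * Ninv * Aᴴ * C = 0 → C = 0 := by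
    intro C hC
    have hY : Ninv * (Aᴴ * C) = 0 := by
      apply hN.eq_zero_of_conjTranspose_mul_mul
      have h : (Ninv * (Aᴴ * C))ᴴ * N * (Ninv * (Aᴴ * C)) = Cᴴ * (A * Ninv * Aᴴ * C) := by
        simp only [conjTranspose_mul, conjTranspose_conjTranspose, hNinv, Matrix.mul_assoc, hNN]
      rw [h, hC, Matrix.mul_zero]
    have hAC : Aᴴ * C = 0 := by rw [← hNN (Aᴴ * C), hY, Matrix.mul_zero]
    rw [← Matrix.one_mul C, ← hBA, Matrix.mul_assoc, hAC, Matrix.mul_zero]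
  have : FiniteDimensional ℝ (Matrix (Fin m) (Fin m) ℍ[ℝ]) :=
    inferInstanceAs (FiniteDimensional ℝ (Fin m → Fin m → ℍ[ℝ]))
  obtain ⟨C, hGC⟩ := exists_mul_eq_one_of_mul_eq_zero hG0
  have hCHG : Cᴴ * (A * Ninv * Aᴴ) = 1 := by
    rw [← hGH, ← conjTranspose_mul, hGC, conjTranspose_one]
  have hCH : Cᴴ = C := left_inv_eq_right_inv hCHG hGC
  have hCG : C * (A * Ninv * Aᴴ) = 1 := by rwa [hCH] at hCHG
  have hinv : Ring.inverse (A * Ninv * Aᴴ) = C :=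
    Ring.inverse_unit ⟨A * Ninv * Aᴴ, C, hGC, hCG⟩
  refine ⟨⟨⟨A * Ninv * Aᴴ, C, hGC, hCG⟩, rfl⟩, ?_⟩
  rw [hinv]
  have hAX : A * (Ninv * Aᴴ * C) = 1 := by rw [← hGC]; simp only [Matrix.mul_assoc]
  refine ⟨?_, ?_, ?_, ?_⟩
  · rw [hAX, Matrix.one_mul]
  · rw [Matrix.mul_assoc, hAX, Matrix.mul_one]
  · rw [Matrix.mul_assoc, hAX, Matrix.mul_one, hM.1]
  · have h : N * (Ninv * Aᴴ * C) * A = Aᴴ * C * A := by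
      rw [Matrix.mul_assoc Ninv, hNN]
    rw [h]
    simp only [conjTranspose_mul, conjTranspose_conjTranspose, hCH, Matrix.mul_assoc]
end

section
/- Let A ∈ ℍ^{m×n}, let M ∈ ℍ^{m×m} and N ∈ ℍ^{n×n} be Hermitian positive definite with N invertible, set A^♯ := N⁻¹ Aᴴ M, and let M₁ ∈ ℍ^{m×m}, N₁ ∈ ℍ^{n×n} be Hermitian positive definite with M₁² = M, N₁² = N, where N₁ is invertible with two-sided inverse N₁⁻¹. Set B := M₁ A N₁⁻¹. Then for every real λ > 0 both λ·I_n + A^♯A and λ·I_n + BᴴB are invertible in the ring of n×n quaternion matrices, and (λ·I_n + A^♯A)⁻¹ A^♯ = N₁⁻¹ (λ·I_n + BᴴB)⁻¹ Bᴴ M₁. -/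
open scoped Quaternion
open Matrix

theorem Quaternion.re_star_dotProduct_self {ι : Type*} [Fintype ι] (x : ι → ℍ[ℝ]) :
    (star x ⬝ᵥ x).re = ∑ i, Quaternion.normSq (x i) := by
  have h : star x ⬝ᵥ x = ((∑ i, Quaternion.normSq (x i) : ℝ) : ℍ[ℝ]) := by
    rw [← Quaternion.algebraMap_def, map_sum]
    exact Finset.sum_congr rfl fun i _ => Quaternion.star_mul_self (x i)
  rw [h, Quaternion.re_coe]

theorem Matrix.eq_zero_of_smul_one_add_conjTranspose_mul_self_mulVec_eq_zero {ι κ : Type*}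
    [Fintype ι] [DecidableEq ι] [Fintype κ] (B : Matrix κ ι ℍ[ℝ]) {l : ℝ} (hl : 0 < l)
    {x : ι → ℍ[ℝ]} (hx : (l • (1 : Matrix ι ι ℍ[ℝ]) + Bᴴ * B) *ᵥ x = 0) : x = 0 := by
  have h : (star x ⬝ᵥ (l • (1 : Matrix ι ι ℍ[ℝ]) + Bᴴ * B) *ᵥ x).re =
      l * ∑ i, Quaternion.normSq (x i) + ∑ i, Quaternion.normSq ((B *ᵥ x) i) := by
    rw [add_mulVec, dotProduct_add, ← mulVec_mulVec, dotProduct_mulVec _ Bᴴ, ← star_mulVec,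
      smul_mulVec, one_mulVec, dotProduct_smul, Quaternion.re_add, Quaternion.re_smul,
      Quaternion.re_star_dotProduct_self, Quaternion.re_star_dotProduct_self, smul_eq_mul]
  rw [hx, dotProduct_zero, Quaternion.re_zero] at h
  have hB : 0 ≤ ∑ i, Quaternion.normSq ((B *ᵥ x) i) :=
    Finset.sum_nonneg fun _ _ => Quaternion.normSq_nonneg
  have hx0 : 0 ≤ ∑ i, Quaternion.normSq (x i) :=
    Finset.sum_nonneg fun _ _ => Quaternion.normSq_nonneg
  have hsum : ∑ i, Quaternion.normSq (x i) = 0 := by nlinarith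
  funext i
  exact Quaternion.normSq_eq_zero.1
    ((Finset.sum_eq_zero_iff_of_nonneg fun _ _ => Quaternion.normSq_nonneg).1 hsum i
      (Finset.mem_univ i))

theorem isUnit_of_mul_eq_zero_imp (𝕜 : Type*) {R : Type*} [Field 𝕜] [Ring R] [Algebra 𝕜 R]
    [FiniteDimensional 𝕜 R] {a : R} (h : ∀ x, a * x = 0 → x = 0) : IsUnit a := by
  have hinj : Function.Injective (LinearMap.mulLeft 𝕜 a) :=
    (injective_iff_map_eq_zero _).2 h
  obtain ⟨b, hb : a * b = 1⟩ := LinearMap.surjective_of_injective hinj 1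
  refine ⟨⟨a, b, hb, sub_eq_zero.1 (h _ ?_)⟩, rfl⟩
  rw [mul_sub, ← mul_assoc, hb, one_mul, mul_one, sub_self]

theorem Matrix.isUnit_smul_one_add_conjTranspose_mul_self {ι κ : Type*}
    [Fintype ι] [DecidableEq ι] [Fintype κ] (B : Matrix κ ι ℍ[ℝ]) {l : ℝ} (hl : 0 < l) :
    IsUnit (l • (1 : Matrix ι ι ℍ[ℝ]) + Bᴴ * B) := by
  refine isUnit_of_mul_eq_zero_imp ℝ fun X hX => ?_
  have hcol (j : ι) : X.col j = 0 :=
    eq_zero_of_smul_one_add_conjTranspose_mul_self_mulVec_eq_zero B hl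
      (funext fun i => congrFun (congrFun hX i) j)
  exact Matrix.ext fun i j => congrFun (hcol j) i

theorem Ring.inverse_conj_of_mul_eq_one {R : Type*} [Ring R] {u v k : R}
    (huv : u * v = 1) (hvu : v * u = 1) (hk : IsUnit k) :
    IsUnit (v * k * u) ∧ Ring.inverse (v * k * u) = v * Ring.inverse k * u := by
  obtain ⟨k, rfl⟩ := hk
  let w : Rˣ := ⟨u, v, huv, hvu⟩
  have h : v * k * u = ↑(w⁻¹ * k * w) := rfl
  rw [h, Ring.inverse_unit, Ring.inverse_unit]
  exact ⟨Units.isUnit _, by simp [w, mul_assoc]⟩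

/-- The resolvent identity
`(λI + A♯A)⁻¹ A♯ = N₁⁻¹ (λI + BᴴB)⁻¹ Bᴴ M₁` with `B = M₁ A N₁⁻¹`, `A♯ = N⁻¹ Aᴴ M`. -/
theorem stmt15 {m n : ℕ} (A : Matrix (Fin m) (Fin n) ℍ[ℝ])
    (M M₁ : Matrix (Fin m) (Fin m) ℍ[ℝ]) (N Ninv N₁ N₁inv : Matrix (Fin n) (Fin n) ℍ[ℝ])
    (hM : IsPosDef M) (hN : IsPosDef N)
    (hN1 : N * Ninv = 1) (hN2 : Ninv * N = 1)
    (hM₁ : IsPosDef M₁) (hN₁ : IsPosDef N₁)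
    (hM₁sq : M₁ * M₁ = M) (hN₁sq : N₁ * N₁ = N)
    (hN₁1 : N₁ * N₁inv = 1) (hN₁2 : N₁inv * N₁ = 1)
    (l : ℝ) (hl : 0 < l) :
    IsUnit (l • (1 : Matrix (Fin n) (Fin n) ℍ[ℝ]) + (Ninv * Aᴴ * M) * A) ∧
    IsUnit (l • (1 : Matrix (Fin n) (Fin n) ℍ[ℝ]) +
      (M₁ * A * N₁inv)ᴴ * (M₁ * A * N₁inv)) ∧
    Ring.inverse (l • (1 : Matrix (Fin n) (Fin n) ℍ[ℝ]) + (Ninv * Aᴴ * M) * A) *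
        (Ninv * Aᴴ * M) =
      N₁inv *
        Ring.inverse (l • (1 : Matrix (Fin n) (Fin n) ℍ[ℝ]) +
          (M₁ * A * N₁inv)ᴴ * (M₁ * A * N₁inv)) *
        (M₁ * A * N₁inv)ᴴ * M₁ := by
  set B := M₁ * A * N₁inv with hB
  have hK := isUnit_smul_one_add_conjTranspose_mul_self B hl
  have hstar : N₁invᴴ = N₁inv := by
    have h : N₁invᴴ * N₁ = 1 := by
      rw [← conjTranspose_one, ← hN₁1, conjTranspose_mul, hN₁.1]
    exact left_inv_eq_right_inv h hN₁1
  have hNinv : Ninv = N₁inv * N₁inv := by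
    refine left_inv_eq_right_inv hN2 ?_
    rw [← hN₁sq, mul_assoc, ← mul_assoc N₁ N₁inv, hN₁1, one_mul, hN₁1]
  have hsharp : Ninv * Aᴴ * M = N₁inv * Bᴴ * M₁ := by
    simp only [hB, hNinv, ← hM₁sq, conjTranspose_mul, hstar, hM₁.1, Matrix.mul_assoc]
  have hA : M₁ * A = B * N₁ := by
    rw [hB, Matrix.mul_assoc, hN₁2, Matrix.mul_one]
  have hG : l • (1 : Matrix (Fin n) (Fin n) ℍ[ℝ]) + Ninv * Aᴴ * M * A =
      N₁inv * (l • (1 : Matrix (Fin n) (Fin n) ℍ[ℝ]) + Bᴴ * B) * N₁ := by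
    rw [hsharp, Matrix.mul_assoc _ M₁ A, hA, mul_add, add_mul, mul_smul_comm, mul_one,
      smul_mul_assoc, hN₁2]
    simp only [Matrix.mul_assoc]
  have hinv := Ring.inverse_conj_of_mul_eq_one hN₁1 hN₁2 hK
  rw [hG]
  refine ⟨hinv.1, hK, ?_⟩
  rw [hinv.2, hsharp]
  simp only [Matrix.mul_assoc]
  rw [← Matrix.mul_assoc N₁ N₁inv, hN₁1, Matrix.one_mul]
end

section
/- Let A ∈ ℍ^{m×n}, let M ∈ ℍ^{m×m} and N ∈ ℍ^{n×n} be Hermitian positive definite with N invertible, set A^♯ := N⁻¹ Aᴴ M, and let X be the weighted Moore–Penrose inverse of A with weights M, N. Let b ∈ ℍᵐ. If a vector x ∈ ℍⁿ satisfies A x = b and lies in the range of A^♯ (i.e., x = A^♯ y for some y ∈ ℍᵐ), then x = X b. In particular, the right linear system A x = b has at most one solution in the range of A^♯, given by x = X b. -/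
open scoped Quaternion
open Matrix

/-- `X A` acts as the identity on the left of `N⁻¹ Aᴴ`. -/
theorem IsWMPInv.mul_mul_inv_mul_conjTranspose {m n : ℕ} {A : Matrix (Fin m) (Fin n) ℍ[ℝ]}
    {M : Matrix (Fin m) (Fin m) ℍ[ℝ]} {N Ninv : Matrix (Fin n) (Fin n) ℍ[ℝ]}
    {X : Matrix (Fin n) (Fin m) ℍ[ℝ]} (hX : IsWMPInv M N A X) (hN : Nᴴ = N)
    (hN1 : N * Ninv = 1) (hN2 : Ninv * N = 1) :
    X * A * (Ninv * Aᴴ) = Ninv * Aᴴ := by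
  obtain ⟨hA, -, -, hH⟩ := hX
  have hA' : Aᴴ * Xᴴ * Aᴴ = Aᴴ := by
    simpa only [conjTranspose_mul, Matrix.mul_assoc] using congrArg conjTranspose hA
  have hH' : Aᴴ * Xᴴ * N = N * (X * A) := by
    simpa only [conjTranspose_mul, hN, Matrix.mul_assoc] using hH
  calc X * A * (Ninv * Aᴴ) = Ninv * N * (X * A) * (Ninv * Aᴴ) := by rw [hN2, Matrix.one_mul]
    _ = Ninv * (N * (X * A)) * (Ninv * Aᴴ) := by simp only [Matrix.mul_assoc]
    _ = Ninv * (Aᴴ * Xᴴ * (N * Ninv) * Aᴴ) := by rw [← hH']; simp only [Matrix.mul_assoc]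
    _ = Ninv * Aᴴ := by rw [hN1, Matrix.mul_one, hA']

/-- The right system `A x = b` restricted to the range of `A♯ = N⁻¹ Aᴴ M` has the
unique solution `x = A⁺_{M,N} b`. -/
theorem stmt16 {m n : ℕ} (A : Matrix (Fin m) (Fin n) ℍ[ℝ])
    (M : Matrix (Fin m) (Fin m) ℍ[ℝ]) (N Ninv : Matrix (Fin n) (Fin n) ℍ[ℝ])
    (hM : IsPosDef M) (hN : IsPosDef N)
    (hN1 : N * Ninv = 1) (hN2 : Ninv * N = 1)
    (X : Matrix (Fin n) (Fin m) ℍ[ℝ]) (hX : IsWMPInv M N A X)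
    (b : Fin m → ℍ[ℝ]) (x : Fin n → ℍ[ℝ])
    (hxA : A.mulVec x = b)
    (hxR : ∃ y : Fin m → ℍ[ℝ], x = (Ninv * Aᴴ * M).mulVec y) :
    x = X.mulVec b := by
  obtain ⟨y, rfl⟩ := hxR
  rw [← hxA, mulVec_mulVec, mulVec_mulVec, ← Matrix.mul_assoc (X * A) (Ninv * Aᴴ),
    hX.mul_mul_inv_mul_conjTranspose hN.1 hN1 hN2]
end

section
/- Let A ∈ ℍ^{m×n}, let M ∈ ℍ^{m×m} and N ∈ ℍ^{n×n} be Hermitian positive definite with N invertible, set A^♯ := N⁻¹ Aᴴ M, and let X be the weighted Moore–Penrose inverse of A with weights M, N. Let b ∈ ℍⁿ be a row vector. If a row vector x ∈ ℍᵐ satisfies x A = b (i.e., (x A)_j = Σ_i x_i A_{ij}) and x lies in the left row space of A^♯ (i.e., x = y A^♯ for some row vector y ∈ ℍⁿ), then x = b X. In particular, the left linear system x A = b has at most one solution in the left row space of A^♯, given by x = b X. -/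
open scoped Quaternion
open Matrix

/-- The left system `x A = b` restricted to the left row space of `A♯ = N⁻¹ Aᴴ M`
has the unique solution `x = b A⁺_{M,N}`. -/
theorem stmt17 {m n : ℕ} (A : Matrix (Fin m) (Fin n) ℍ[ℝ])
    (M : Matrix (Fin m) (Fin m) ℍ[ℝ]) (N Ninv : Matrix (Fin n) (Fin n) ℍ[ℝ])
    (hM : IsPosDef M) (hN : IsPosDef N)
    (hN1 : N * Ninv = 1) (hN2 : Ninv * N = 1)
    (X : Matrix (Fin n) (Fin m) ℍ[ℝ]) (hX : IsWMPInv M N A X)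
    (b : Fin n → ℍ[ℝ]) (x : Fin m → ℍ[ℝ])
    (hxA : Matrix.vecMul x A = b)
    (hxR : ∃ y : Fin n → ℍ[ℝ], x = Matrix.vecMul y (Ninv * Aᴴ * M)) :
    x = Matrix.vecMul b X := by
  obtain ⟨y, rfl⟩ := hxR
  obtain ⟨hAXA, -, hMAX, -⟩ := hX
  have key : Aᴴ * M * A * X = Aᴴ * M :=
    calc Aᴴ * M * A * X = Aᴴ * (M * A * X) := by simp only [Matrix.mul_assoc]
      _ = Aᴴ * (M * A * X)ᴴ := by rw [hMAX]
      _ = (A * X * A)ᴴ * Mᴴ := by simp only [conjTranspose_mul, Matrix.mul_assoc]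
      _ = Aᴴ * M := by rw [hAXA, hM.1]
  rw [← hxA, vecMul_vecMul, vecMul_vecMul]
  congr 1
  calc Ninv * Aᴴ * M = Ninv * (Aᴴ * M * A * X) := by rw [key, Matrix.mul_assoc]
    _ = Ninv * Aᴴ * M * (A * X) := by simp only [Matrix.mul_assoc]
end
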